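/- Let f = (f_1,…,f_s) ⊂ ℝ[x_1,…,x_n] generate a radical ideal and define a smooth equidimensional algebraic set V ⊂ ℂ^n of dimension d. Then there exists a nonempty Zariski open subset 𝒜_f of GL(n,ℂ) such that for every A ∈ 𝒜_f and every 1 ≤ i ≤ d+1, the restriction of the projection φ_{i−1} to crit(φ_i, V^A) is a proper map (with the conventions φ_0 : x ↦ • the constant map and crit(φ_{d+1}, V^A) = V^A). -/

import Mathlib

open MvPolynomial

noncomputable section

/-- The common zero locus in `F^σ` of a set of polynomials. -/
def zLocus {σ F : Type*} [CommSemiring F] (S : Set (MvPolynomial σ F)) : Set (σ → F) :=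
  {x | ∀ p ∈ S, eval x p = 0}

/-- The vanishing ideal of a subset of `F^σ`. -/
def vIdeal {σ F : Type*} [CommRing F] (V : Set (σ → F)) : Ideal (MvPolynomial σ F) where
  carrier := {p | ∀ x ∈ V, eval x p = 0}
  add_mem' := by
    intro p q hp hq x hx
    simp [hp x hx, hq x hx]
  zero_mem' := by intro x hx; simp
  smul_mem' := by
    intro c p hp x hx
    simp [smul_eq_mul, hp x hx]

/-- The dimension of an algebraic set, as the Krull dimension of its coordinate ring. -/
def setDim {σ : Type*} (V : Set (σ → ℂ)) : WithBot (WithTop ℕ) :=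
  ringKrullDim (MvPolynomial σ ℂ ⧸ vIdeal V)

/-- An ideal is equidimensional of dimension `d` if every minimal prime over it has
quotient of Krull dimension `d`. -/
def EquidimIdeal {R : Type*} [CommRing R] (I : Ideal R) (d : ℕ) : Prop :=
  ∀ P ∈ I.minimalPrimes, ringKrullDim (R ⧸ P) = (d : WithBot (WithTop ℕ))

/-- Differential at a point `p₀` of the polynomial `g`, applied to the vector `v`. -/
def polyDiff {σ : Type*} [Fintype σ] [DecidableEq σ] (p₀ : σ → ℂ) (g : MvPolynomial σ ℂ)
    (v : σ → ℂ) : ℂ :=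
  ∑ j, v j * eval p₀ (pderiv j g)

/-- The Zariski tangent space of `V` at `p₀`. -/
def tangentAt {σ : Type*} [Fintype σ] [DecidableEq σ] (V : Set (σ → ℂ)) (p₀ : σ → ℂ) :
    Submodule ℂ (σ → ℂ) where
  carrier := {v | ∀ g ∈ vIdeal V, polyDiff p₀ g v = 0}
  add_mem' := by
    intro a b ha hb g hg
    have h1 := ha g hg
    have h2 := hb g hg
    simp only [polyDiff, Pi.add_apply, add_mul, Finset.sum_add_distrib] at *
    simp [h1, h2]
  zero_mem' := by intro g hg; simp [polyDiff]
  smul_mem' := by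
    intro c a ha g hg
    have h1 := ha g hg
    simp only [polyDiff, Pi.smul_apply, smul_eq_mul, mul_assoc, ← Finset.mul_sum] at *
    simp [h1]

/-- The singular locus of `V`, relative to the expected dimension `d`:
points of `V` where the Zariski tangent space does not have dimension `d`. -/
def singLocus {σ : Type*} [Fintype σ] [DecidableEq σ] (V : Set (σ → ℂ)) (d : ℕ) :
    Set (σ → ℂ) :=
  {p | p ∈ V ∧ Module.finrank ℂ (tangentAt V p) ≠ d}

/-- Critical points of the polynomial map with components `φ` restricted to the
nonsingular locus of `V` (`V` of expected dimension `d`). -/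
def critMap {σ : Type*} [Fintype σ] [DecidableEq σ] {ι : Type*}
    (V : Set (σ → ℂ)) (d : ℕ) (φ : ι → MvPolynomial σ ℂ) : Set (σ → ℂ) :=
  {p | p ∈ V ∧ p ∉ singLocus V d ∧
    ¬ Function.Surjective (fun v : tangentAt V p => fun k : ι => polyDiff p (φ k) v)}

/-- The components of the projection on the first `i` coordinates, as polynomials. -/
def projPoly (n i : ℕ) : Fin i → MvPolynomial (Fin n) ℂ :=
  fun k => if h : (k : ℕ) < n then X ⟨k, h⟩ else 0

/-- Critical locus of the projection to the first `i` coordinates restricted to `V`,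
with the convention that for `i = d+1` it is all of `V`. -/
def critProj {n : ℕ} (V : Set (Fin n → ℂ)) (d i : ℕ) : Set (Fin n → ℂ) :=
  if i = d + 1 then V else critMap V d (projPoly n i)

/-- Projection of `ℂ^n` to the first `i` coordinates. -/
def projMap (n i : ℕ) (x : Fin n → ℂ) : Fin i → ℂ :=
  fun k => if h : (k : ℕ) < n then x ⟨k, h⟩ else 0

/-- `φ` restricted to `V` is proper at `β` (Euclidean topology). -/
def ProperAt {n i : ℕ} (φ : (Fin n → ℂ) → Fin i → ℂ) (V : Set (Fin n → ℂ))
    (β : Fin i → ℂ) : Prop :=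
  ∃ O : Set (Fin i → ℂ), IsOpen O ∧ β ∈ O ∧ IsCompact {x | x ∈ V ∧ φ x ∈ closure O}

/-- `φ` restricted to `V` is a proper map (onto its image). -/
def ProperOn {n i : ℕ} (φ : (Fin n → ℂ) → Fin i → ℂ) (V : Set (Fin n → ℂ)) : Prop :=
  ∀ β ∈ φ '' V, ProperAt φ V β

/-- Zariski open subsets of `F^k`: complements of zero loci of sets of polynomials. -/
def IsZariskiOpen {k : ℕ} {F : Type*} [CommSemiring F] (U : Set (Fin k → F)) : Prop :=
  ∃ S : Set (MvPolynomial (Fin k) F), U = {x | ∃ p ∈ S, eval x p ≠ 0}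

/-- Zariski open subsets of the space of `n × n` matrices over `F`. -/
def IsZariskiOpenMat {n : ℕ} {F : Type*} [CommSemiring F]
    (U : Set (Matrix (Fin n) (Fin n) F)) : Prop :=
  ∃ S : Set (MvPolynomial (Fin n × Fin n) F),
    U = {A | ∃ p ∈ S, eval (fun q => A q.1 q.2) p ≠ 0}

/-- Complexification of a rational polynomial. -/
def toC {σ : Type*} (p : MvPolynomial σ ℚ) : MvPolynomial σ ℂ :=
  MvPolynomial.map (algebraMap ℚ ℂ) p

/-- The change of variables `x ↦ A·x` acting on the `x`-variables only
(the `y`-variables are left invariant). -/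
def chgX {n t : ℕ} {F : Type*} [CommRing F] (A : Matrix (Fin n) (Fin n) F)
    (p : MvPolynomial (Fin n ⊕ Fin t) F) : MvPolynomial (Fin n ⊕ Fin t) F :=
  aeval (Sum.elim (fun j => ∑ k, C (A j k) * X (Sum.inl k)) (fun l => X (Sum.inr l))) p

/-- Specialization of the `y`-variables at the point `η`. -/
def specY {n t : ℕ} {F : Type*} [CommRing F] (η : Fin t → F)
    (p : MvPolynomial (Fin n ⊕ Fin t) F) : MvPolynomial (Fin n) F :=
  aeval (Sum.elim X (fun l => C (η l))) p

/-- Jacobian matrix w.r.t. the `x`-variables, evaluated at a point `z ∈ ℂ^{n+t}`. -/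
def jacXAt {n t s : ℕ} (f : Fin s → MvPolynomial (Fin n ⊕ Fin t) ℂ)
    (z : (Fin n ⊕ Fin t) → ℂ) : Matrix (Fin s) (Fin n) ℂ :=
  Matrix.of fun i j => eval z (pderiv (Sum.inl j) (f i))

/-- Symbolic Jacobian matrix of a polynomial system in the variables `x`. -/
def jacPoly {n s : ℕ} {F : Type*} [CommRing F] (g : Fin s → MvPolynomial (Fin n) F) :
    Matrix (Fin s) (Fin n) (MvPolynomial (Fin n) F) :=
  Matrix.of fun i j => pderiv j (g i)

/-- Symbolic Jacobian matrix w.r.t. the `x`-variables of a system in variables `(x,y)`. -/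
def jacPolyX {n t s : ℕ} {F : Type*} [CommRing F]
    (f : Fin s → MvPolynomial (Fin n ⊕ Fin t) F) :
    Matrix (Fin s) (Fin n) (MvPolynomial (Fin n ⊕ Fin t) F) :=
  Matrix.of fun i j => pderiv (Sum.inl j) (f i)

/-- The set of `k`-minors of `M` using only columns of index `≥ i` (0-indexed). -/
def minorsGE {s n : ℕ} {R : Type*} [CommRing R] (M : Matrix (Fin s) (Fin n) R)
    (k i : ℕ) : Set R :=
  {q | ∃ (r : Fin k → Fin s) (c : Fin k → Fin n), Function.Injective r ∧
        Function.Injective c ∧ (∀ l, i ≤ (c l : ℕ)) ∧ q = (M.submatrix r c).det}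

/-- Semi-algebraic formulas over `ℚ[y_1,…,y_t]`: boolean combinations of polynomial
sign conditions. -/
inductive SAForm (t : ℕ) : Type
  | eq (p : MvPolynomial (Fin t) ℚ) : SAForm t
  | pos (p : MvPolynomial (Fin t) ℚ) : SAForm t
  | nonneg (p : MvPolynomial (Fin t) ℚ) : SAForm t
  | ne (p : MvPolynomial (Fin t) ℚ) : SAForm t
  | conj (φ ψ : SAForm t) : SAForm t
  | disj (φ ψ : SAForm t) : SAForm t
  | neg (φ : SAForm t) : SAForm t

/-- Truth value of a semi-algebraic formula at a point of `ℝ^t`. -/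
def SAForm.holds {t : ℕ} : SAForm t → (Fin t → ℝ) → Prop
  | eq p, y => aeval y p = 0
  | pos p, y => 0 < aeval y p
  | nonneg p, y => 0 ≤ aeval y p
  | ne p, y => aeval y p ≠ 0
  | conj φ ψ, y => φ.holds y ∧ ψ.holds y
  | disj φ ψ, y => φ.holds y ∨ ψ.holds y
  | neg φ, y => ¬ φ.holds y

/-- The maximal total degree of the polynomials involved in a semi-algebraic formula. -/
def SAForm.deg {t : ℕ} : SAForm t → ℕ
  | eq p => p.totalDegree
  | pos p => p.totalDegree
  | nonneg p => p.totalDegree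
  | ne p => p.totalDegree
  | conj φ ψ => max φ.deg ψ.deg
  | disj φ ψ => max φ.deg ψ.deg
  | neg φ => φ.deg

/-- The solution set `Z(Φ) ⊆ ℝ^t` of a semi-algebraic formula. -/
def SAForm.zset {t : ℕ} (φ : SAForm t) : Set (Fin t → ℝ) := {y | φ.holds y}

/-- The real points of the variety defined by a rational system in variables `(x, y)`. -/
def realPts {n t s : ℕ} (f : Fin s → MvPolynomial (Fin n ⊕ Fin t) ℚ) :
    Set ((Fin n ⊕ Fin t) → ℝ) :=
  {z | ∀ i, aeval z (f i) = 0}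

/-- The real zero set of a set of rational polynomials. -/
def realZeros {σ : Type*} (S : Set (MvPolynomial σ ℚ)) : Set (σ → ℝ) :=
  {z | ∀ p ∈ S, aeval z p = 0}

/-- The projection `(x, y) ↦ y` on real points. -/
def projY {n t : ℕ} (z : (Fin n ⊕ Fin t) → ℝ) : Fin t → ℝ := z ∘ Sum.inr

/-- The projection `(x, y) ↦ y` on complex points. -/
def projYC {n t : ℕ} (z : (Fin n ⊕ Fin t) → ℂ) : Fin t → ℂ := z ∘ Sum.inr

/-- The complex algebraic set defined by a rational polynomial system. -/
def VC {n t s : ℕ} (f : Fin s → MvPolynomial (Fin n ⊕ Fin t) ℚ) :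
    Set ((Fin n ⊕ Fin t) → ℂ) :=
  zLocus (Set.range fun i => toC (f i))

/-- Assumption A: the ideal generated by `f` is radical, and its algebraic set is
(nonempty) equidimensional of dimension `d + t` with singular locus of dimension `< t`. -/
def AssumpA {n t s : ℕ} (f : Fin s → MvPolynomial (Fin n ⊕ Fin t) ℚ) (d : ℕ) : Prop :=
  (Ideal.span (Set.range f)).IsRadical ∧
  (VC f).Nonempty ∧
  EquidimIdeal (vIdeal (VC f)) (d + t) ∧
  setDim (singLocus (VC f) (d + t)) < (t : WithBot (WithTop ℕ))

/-- Assumption B: the Zariski closure of `π(V)` is all of `ℂ^t` (no nonzero polynomial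
vanishes on `π(V)`), and `π(V ∩ ℝ^{t+n})` has nonzero Lebesgue measure. -/
def AssumpB {n t s : ℕ} (f : Fin s → MvPolynomial (Fin n ⊕ Fin t) ℚ) : Prop :=
  (∀ p : MvPolynomial (Fin t) ℂ, (∀ z ∈ VC f, eval (projYC z) p = 0) → p = 0) ∧
  MeasureTheory.volume (projY '' realPts f) ≠ 0

/-- The conclusion of Lemma (B-param): the system `g` generates a radical
equidimensional ideal whose algebraic set is either empty or smooth of dimension `d`. -/
def GoodSpec {n s : ℕ} (g : Fin s → MvPolynomial (Fin n) ℂ) (d : ℕ) : Prop :=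
  (Ideal.span (Set.range g)).IsRadical ∧
  (zLocus (Set.range g) = ∅ ∨
    (EquidimIdeal (Ideal.span (Set.range g)) d ∧ singLocus (zLocus (Set.range g)) d = ∅))

/-- The field `ℚ(y_1, …, y_t)` of rational fractions. -/
abbrev RatFunc' (t : ℕ) : Type := FractionRing (MvPolynomial (Fin t) ℚ)

/-- View a polynomial of `ℚ[x, y]` as a polynomial of `ℚ(y)[x]`. -/
def toKx {n t : ℕ} (p : MvPolynomial (Fin n ⊕ Fin t) ℚ) :
    MvPolynomial (Fin n) (RatFunc' t) :=
  eval₂ ((C : RatFunc' t →+* MvPolynomial (Fin n) (RatFunc' t)).comp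
      ((algebraMap (MvPolynomial (Fin t) ℚ) (RatFunc' t)).comp (C : ℚ →+* MvPolynomial (Fin t) ℚ)))
    (Sum.elim X (fun l => C (algebraMap (MvPolynomial (Fin t) ℚ) (RatFunc' t) (X l)))) p

/-- Extension of a vector of `Fin d` to a function on `ℕ` (by zero). -/
def extFun {d : ℕ} {F : Type*} [Zero F] (α : Fin d → F) : ℕ → F :=
  fun k => if h : k < d then α ⟨k, h⟩ else 0

/-- The polynomial system `W_i^{A,α}` (over the ground field `F`, the change of
variables being already performed): the input equations, the `(n-d)`-minors of the
truncated Jacobian (except when `i = d+1`), and the equations `x_k = α_k`, `k ≤ i-1`. -/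
def Wsys {n s : ℕ} {F : Type*} [CommRing F] (g : Fin s → MvPolynomial (Fin n) F)
    (d i : ℕ) (a : ℕ → F) : Set (MvPolynomial (Fin n) F) :=
  Set.range g ∪ (if i = d + 1 then ∅ else minorsGE (jacPoly g) (n - d) i) ∪
  {q | ∃ k : Fin n, (k : ℕ) < i - 1 ∧ q = X k - C (a k)}

/-- The polynomial system `W_i^{A,α}` viewed in `ℚ[y][x]` (variables `(x,y)`). -/
def WsysXY {n t s : ℕ} (f : Fin s → MvPolynomial (Fin n ⊕ Fin t) ℚ)
    (d i : ℕ) (a : ℕ → ℚ) : Set (MvPolynomial (Fin n ⊕ Fin t) ℚ) :=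
  Set.range f ∪ (if i = d + 1 then ∅ else minorsGE (jacPolyX f) (n - d) i) ∪
  {q | ∃ k : Fin n, (k : ℕ) < i - 1 ∧ q = X (Sum.inl k) - C (a k)}

/-- A commutative ring is Cohen–Macaulay if, for every maximal ideal `m`, there is a
regular sequence contained in `m` of length the height of `m`. -/
def IsCMRing (R : Type*) [CommRing R] : Prop :=
  ∀ m : Ideal R, ∀ hm : m.IsMaximal, ∃ rs : List R,
    (∀ r ∈ rs, r ∈ m) ∧ RingTheory.Sequence.IsRegular R rs ∧
    (rs.length : WithBot (WithTop ℕ)) = ringKrullDim (@Localization.AtPrime R _ m hm.isPrime)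

/-- Homogenization of a polynomial w.r.t. all its variables, using a fresh variable. -/
def homog {σ : Type*} {F : Type*} [CommSemiring F] [DecidableEq σ] (p : MvPolynomial σ F) :
    MvPolynomial (σ ⊕ Unit) F :=
  p.support.sum fun m =>
    monomial (m.mapDomain Sum.inl +
        Finsupp.single (Sum.inr ()) (p.totalDegree - m.sum fun _ e => e)) (coeff m p)

/-- Zariski open subsets of the space `ℂ[x,y]^s_{≤D}` of `s`-tuples of polynomials of
total degree at most `D`, described by polynomial conditions on the coefficients. -/
def IsZariskiOpenTuple {n t : ℕ} (s D : ℕ)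
    (U : Set (Fin s → MvPolynomial (Fin n ⊕ Fin t) ℂ)) : Prop :=
  ∃ S : Set (MvPolynomial (Fin s × ((Fin n ⊕ Fin t) →₀ ℕ)) ℂ),
    U = {f | (∀ i, (f i).totalDegree ≤ D) ∧
          ∃ p ∈ S, eval (fun im => coeff im.2 (f im.1)) p ≠ 0}

/-- Zariski open subsets of the product of the space of `n×n` complex matrices with `ℂ^n`. -/
def IsZariskiOpenMatVec {n : ℕ}
    (U : Set (Matrix (Fin n) (Fin n) ℂ × (Fin n → ℂ))) : Prop :=
  ∃ S : Set (MvPolynomial ((Fin n × Fin n) ⊕ Fin n) ℂ),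
    U = {Aα | ∃ p ∈ S, eval (Sum.elim (fun q => Aα.1 q.1 q.2) Aα.2) p ≠ 0}



/-- Derivations dual to an algebraically independent family in a f.g. field extension. -/
lemma exists_dual_derivation {κ : Type} [DecidableEq κ] {K : Type} [Field K] [Algebra ℂ K]
    [Algebra.EssFiniteType ℂ K] (Φ : κ → K) (h : AlgebraicIndependent ℂ Φ) (l : κ) :
    ∃ D : Derivation ℂ K K, ∀ j, D (Φ j) = if j = l then 1 else 0 := by
  let : Algebra (MvPolynomial κ ℂ) K := (aeval Φ : MvPolynomial κ ℂ →ₐ[ℂ] K).toRingHom.toAlgebra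
  have hmap : ∀ p, algebraMap (MvPolynomial κ ℂ) K p = aeval Φ p := fun p => rfl
  have : IsScalarTower ℂ (MvPolynomial κ ℂ) K :=
    IsScalarTower.of_algebraMap_eq fun r => by simp [hmap]
  have : FaithfulSMul (MvPolynomial κ ℂ) K :=
    (faithfulSMul_iff_algebraMap_injective _ _).2 h
  let : Algebra (FractionRing (MvPolynomial κ ℂ)) K := FractionRing.liftAlgebra _ _
  have : IsScalarTower (MvPolynomial κ ℂ) (FractionRing (MvPolynomial κ ℂ)) K :=
    FractionRing.isScalarTower_liftAlgebra _ _
  have : IsScalarTower ℂ (FractionRing (MvPolynomial κ ℂ)) K := by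
    refine IsScalarTower.of_algebraMap_eq fun r => ?_
    rw [IsScalarTower.algebraMap_apply ℂ (MvPolynomial κ ℂ) K,
      IsScalarTower.algebraMap_apply ℂ (MvPolynomial κ ℂ) (FractionRing (MvPolynomial κ ℂ)),
      IsScalarTower.algebraMap_apply (MvPolynomial κ ℂ) (FractionRing (MvPolynomial κ ℂ)) K]
  have : Algebra.EssFiniteType (FractionRing (MvPolynomial κ ℂ)) K :=
    Algebra.EssFiniteType.of_comp ℂ _ _
  have : CharZero (FractionRing (MvPolynomial κ ℂ)) := algebraRat.charZero _
  have : Algebra.FormallySmooth (FractionRing (MvPolynomial κ ℂ)) K := inferInstance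
  have : Algebra.FormallySmooth (MvPolynomial κ ℂ) (FractionRing (MvPolynomial κ ℂ)) :=
    .of_isLocalization (nonZeroDivisors _)
  have : Algebra.FormallySmooth (MvPolynomial κ ℂ) K :=
    .comp _ (FractionRing (MvPolynomial κ ℂ)) _
  let Ψ : MvPolynomial κ ℂ →ₐ[ℂ] TrivSqZeroExt K K :=
    aeval fun j => TrivSqZeroExt.inl (Φ j) + TrivSqZeroExt.inr (if j = l then 1 else 0)
  have hΨ : ∀ p, TrivSqZeroExt.fst (Ψ p) = aeval Φ p := by
    intro p
    have : ((TrivSqZeroExt.fstHom ℂ K K).comp Ψ) = aeval Φ := by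
      ext j; by_cases hj : j = l <;> simp [Ψ, hj]
    exact DFunLike.congr_fun this p
  let i1 : Algebra (MvPolynomial κ ℂ) (TrivSqZeroExt K K) := Ψ.toRingHom.toAlgebra
  have hmap2 : ∀ p, @algebraMap _ _ _ _ i1 p = Ψ p := fun p => rfl
  let fst : TrivSqZeroExt K K →ₐ[MvPolynomial κ ℂ] K :=
    { (TrivSqZeroExt.fstHom ℂ K K).toRingHom with
      commutes' := fun p => hΨ p }
  have hfst : ∀ x, fst x = TrivSqZeroExt.fst x := fun x => rfl
  have hs : Function.Surjective fst := fun x => ⟨TrivSqZeroExt.inl x, rfl⟩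
  have hn : IsNilpotent (RingHom.ker (fst : TrivSqZeroExt K K →+* K)) := by
    refine ⟨2, ?_⟩
    refine (pow_two (M := Ideal (TrivSqZeroExt K K)) _).trans ?_
    rw [Ideal.zero_eq_bot, eq_bot_iff, Ideal.mul_le]
    intro a ha b hb
    have ha' : TrivSqZeroExt.fst a = 0 := ha
    have hb' : TrivSqZeroExt.fst b = 0 := hb
    rw [Ideal.mem_bot]
    ext <;> simp [ha', hb']
  let σ := Algebra.FormallySmooth.liftOfSurjective (AlgHom.id (MvPolynomial κ ℂ) K) fst hs hn
  have hσ : ∀ x, TrivSqZeroExt.fst (σ x) = x := fun x =>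
    Algebra.FormallySmooth.liftOfSurjective_apply (AlgHom.id (MvPolynomial κ ℂ) K) fst hs hn x
  have hσ2 : ∀ p, σ (aeval Φ p) = Ψ p := fun p => σ.commutes p
  refine ⟨Derivation.mk' (R := ℂ) (A := K) (M := K)
    { toFun := fun x => TrivSqZeroExt.snd (σ x)
      map_add' := fun x y => by simp
      map_smul' := fun c x => ?_ } ?_, ?_⟩
  · have := hσ2 (C c)
    rw [Algebra.smul_def, map_mul]
    rw [aeval_C] at this
    rw [this]
    have hc : Ψ (C c) = TrivSqZeroExt.inl (algebraMap ℂ K c) := by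
      simp only [Ψ, aeval_C]; rfl
    simp [hc, hσ, Algebra.smul_def]
  · intro a b
    simp [hσ, mul_comm]
  · intro j
    have := hσ2 (X j)
    rw [aeval_X] at this
    have h2 : TrivSqZeroExt.snd (σ (Φ j)) = if j = l then 1 else 0 := by
      rw [this]
      by_cases hj : j = l <;> simp [Ψ, hj]
    exact h2

lemma derivation_aeval {n : ℕ} {K : Type} [Field K] [Algebra ℂ K] (D : Derivation ℂ K K)
    (x : Fin n → K) (g : MvPolynomial (Fin n) ℂ) :
    D (aeval x g) = ∑ a, aeval x (pderiv a g) * D (x a) := by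
  induction g using MvPolynomial.induction_on with
  | C c => simp
  | add p q hp hq => simp [hp, hq, add_mul, Finset.sum_add_distrib]
  | mul_X p i hp =>
    simp only [map_mul, aeval_X, Derivation.leibniz, hp, smul_eq_mul, map_add, pderiv_X,
      add_mul, Finset.sum_add_distrib, Finset.mul_sum]
    congr 1
    · rw [Finset.sum_eq_single i]
      · simp
      · intro b _ hb; simp [hb.symm]
      · simp
    · refine Finset.sum_congr rfl fun a _ => by ring

/-- Products over minimal primes: pointwise algebraic dependence becomes global. -/
lemma exists_relation {τ κ : Type} [Finite τ] (I : Ideal (MvPolynomial τ ℂ))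
    (Φ : κ → MvPolynomial τ ℂ)
    (h : ∀ q : Ideal (MvPolynomial τ ℂ), q.IsPrime → I ≤ q →
      ∃ P : MvPolynomial κ ℂ, P ≠ 0 ∧ aeval Φ P ∈ q) :
    ∃ P : MvPolynomial κ ℂ, P ≠ 0 ∧ ∀ z : τ → ℂ, (∀ p ∈ I, eval z p = 0) →
      eval (fun k => eval z (Φ k)) P = 0 := by
  classical
  have hfin : I.minimalPrimes.Finite := Ideal.finite_minimalPrimes_of_isNoetherianRing _ I
  have h' : ∀ q : Ideal (MvPolynomial τ ℂ), ∃ P : MvPolynomial κ ℂ, P ≠ 0 ∧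
      (q ∈ I.minimalPrimes → aeval Φ P ∈ q) := by
    intro q
    by_cases hq : q ∈ I.minimalPrimes
    · obtain ⟨P, h0, h1⟩ := h q hq.1.1 hq.1.2
      exact ⟨P, h0, fun _ => h1⟩
    · exact ⟨1, one_ne_zero, fun h => absurd h hq⟩
  choose P hP0 hP using h'
  refine ⟨∏ q ∈ hfin.toFinset, P q, Finset.prod_ne_zero_iff.2 fun q _ => hP0 q, ?_⟩
  intro z hz
  have hle : I ≤ RingHom.ker (eval z) := fun p hp => hz p hp
  have hpr : (RingHom.ker (eval z)).IsPrime := RingHom.ker_isPrime _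
  obtain ⟨q, hq, hqle⟩ := Ideal.exists_minimalPrimes_le hle
  have h1 : eval z (aeval Φ (P q)) = 0 := hqle (hP q hq)
  have h2 : ∀ Q : MvPolynomial κ ℂ, eval z (aeval Φ Q) = eval (fun k => eval z (Φ k)) Q := by
    intro Q
    induction Q using MvPolynomial.induction_on with
    | C c => simp
    | add p q hp hq => simp [-aeval_eq_bind₁, hp, hq]
    | mul_X p i hp => simp [-aeval_eq_bind₁, hp]
  rw [map_prod]
  exact Finset.prod_eq_zero (hfin.mem_toFinset.2 hq) (by rw [← h2]; exact h1)

lemma sard_core {n r : ℕ} (g : Fin r → MvPolynomial (Fin n) ℂ) {J : Type} [Fintype J]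
    [DecidableEq J] (e : J → Fin n) (l : J) {K : Type} [Field K] [Algebra ℂ K]
    [Algebra.EssFiniteType ℂ K] (b : Fin n → Fin n → K) (x : Fin n → K) (lam : J → K)
    (mu : Fin r → K) (h1 : ∀ m, aeval x (g m) = 0)
    (h2 : ∀ a, ∑ j, lam j * b (e j) a = ∑ m, mu m * aeval x (pderiv a (g m)))
    (hl : lam l = 1) :
    ¬ AlgebraicIndependent ℂ (Sum.elim (fun j => ∑ a, b (e j) a * x a) (fun q => b q.1 q.2) :
      J ⊕ (Fin n × Fin n) → K) := by
  intro hind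
  obtain ⟨D, hD⟩ := exists_dual_derivation _ hind (Sum.inl l)
  have hDb : ∀ i a, D (b i a) = 0 := by
    intro i a
    simpa using hD (Sum.inr (i, a))
  have hDy : ∀ j, ∑ a, b (e j) a * D (x a) = if j = l then 1 else 0 := by
    intro j
    have := hD (Sum.inl j)
    simpa [hDb] using this
  have hg : ∀ m, ∑ a, aeval x (pderiv a (g m)) * D (x a) = 0 := by
    intro m
    rw [← derivation_aeval D, h1, map_zero]
  have h3 : ∑ j, lam j * ∑ a, b (e j) a * D (x a) = 0 := by
    calc ∑ j, lam j * ∑ a, b (e j) a * D (x a)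
        = ∑ a, (∑ j, lam j * b (e j) a) * D (x a) := by
          simp only [Finset.mul_sum, Finset.sum_mul]
          rw [Finset.sum_comm]
          exact Finset.sum_congr rfl fun a _ => Finset.sum_congr rfl fun j _ => by ring
      _ = ∑ m, mu m * ∑ a, aeval x (pderiv a (g m)) * D (x a) := by
          simp only [h2]
          simp only [Finset.mul_sum, Finset.sum_mul]
          rw [Finset.sum_comm]
          exact Finset.sum_congr rfl fun a _ => Finset.sum_congr rfl fun j _ => by ring
      _ = 0 := by simp [hg]
  simp [hDy, hl] at h3

/-- Algebraic Sard for families of linear projections. -/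
lemma sard_one {n r : ℕ} (g : Fin r → MvPolynomial (Fin n) ℂ) {J : Type} [Fintype J]
    [DecidableEq J] (e : J → Fin n) (l : J) :
    ∃ P : MvPolynomial (J ⊕ (Fin n × Fin n)) ℂ, P ≠ 0 ∧
      ∀ (B : Fin n → Fin n → ℂ) (v : Fin n → ℂ) (lam : J → ℂ) (mu : Fin r → ℂ),
        (∀ m, eval v (g m) = 0) →
        (∀ a, ∑ j, lam j * B (e j) a = ∑ m, mu m * eval v (pderiv a (g m))) →
        lam l = 1 →
        eval (Sum.elim (fun j => ∑ a, B (e j) a * v a) (fun q => B q.1 q.2)) P = 0 := by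
  classical
  let τ := (Fin n × Fin n) ⊕ Fin n ⊕ J ⊕ Fin r
  let bv : Fin n → Fin n → MvPolynomial τ ℂ := fun i a => X (Sum.inl (i, a))
  let xv : Fin n → MvPolynomial τ ℂ := fun a => X (Sum.inr (Sum.inl a))
  let lv : J → MvPolynomial τ ℂ := fun j => X (Sum.inr (Sum.inr (Sum.inl j)))
  let mv : Fin r → MvPolynomial τ ℂ := fun m => X (Sum.inr (Sum.inr (Sum.inr m)))
  let E1 : Fin r → MvPolynomial τ ℂ := fun m => aeval xv (g m)
  let E2 : Fin n → MvPolynomial τ ℂ := fun a =>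
    ∑ j, lv j * bv (e j) a - ∑ m, mv m * aeval xv (pderiv a (g m))
  let I : Ideal (MvPolynomial τ ℂ) := Ideal.span (Set.range E1 ∪ Set.range E2 ∪ {lv l - 1})
  let Φ : J ⊕ (Fin n × Fin n) → MvPolynomial τ ℂ :=
    Sum.elim (fun j => ∑ a, bv (e j) a * xv a) (fun q => bv q.1 q.2)
  obtain ⟨P, hP0, hP⟩ := exists_relation I Φ (by
    intro q hq hIq
    by_contra hcon
    push Not at hcon
    let K := FractionRing (MvPolynomial τ ℂ ⧸ q)
    let π : MvPolynomial τ ℂ →ₐ[ℂ] K :=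
      (IsScalarTower.toAlgHom ℂ (MvPolynomial τ ℂ ⧸ q) K).comp (Ideal.Quotient.mkₐ ℂ q)
    have hπ : ∀ p, π p = 0 ↔ p ∈ q := by
      intro p
      have : π p = algebraMap (MvPolynomial τ ℂ ⧸ q) K (Ideal.Quotient.mk q p) := rfl
      rw [this, ← Ideal.Quotient.eq_zero_iff_mem]
      exact map_eq_zero_iff _ (IsFractionRing.injective (MvPolynomial τ ℂ ⧸ q) K)
    have : Algebra.EssFiniteType (MvPolynomial τ ℂ ⧸ q) K :=
      Algebra.EssFiniteType.of_isLocalization K (nonZeroDivisors (MvPolynomial τ ℂ ⧸ q))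
    have : Algebra.EssFiniteType ℂ K :=
      Algebra.EssFiniteType.comp ℂ (MvPolynomial τ ℂ ⧸ q) K
    have hind : AlgebraicIndependent ℂ (fun k => π (Φ k)) := by
      rw [algebraicIndependent_iff]
      intro p hp
      by_contra hp0
      apply hcon p hp0
      rw [← hπ]
      rw [← hp]
      exact (DFunLike.congr_fun (comp_aeval Φ π) p)
    have hπg : ∀ p, π (aeval xv p) = aeval (fun a => π (xv a)) p := fun p =>
      (DFunLike.congr_fun (comp_aeval xv π) p)
    refine sard_core g e l (fun i a => π (bv i a)) (fun a => π (xv a)) (fun j => π (lv j))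
      (fun m => π (mv m)) ?_ ?_ ?_ ?_
    · intro m
      rw [← hπg]
      exact (hπ _).2 (hIq (Ideal.subset_span (by simp [E1, -aeval_eq_bind₁])))
    · intro a
      have h1 : π (E2 a) = 0 := (hπ _).2 (hIq (Ideal.subset_span (by simp)))
      simp only [E2, map_sub, map_sum, map_mul, hπg] at h1
      exact sub_eq_zero.1 h1
    · have h1 : π (lv l - 1) = 0 := (hπ _).2 (hIq (Ideal.subset_span (by simp)))
      rw [map_sub, map_one] at h1
      exact sub_eq_zero.1 h1
    · have hk : (fun k => π (Φ k)) = Sum.elim (fun j => ∑ a, π (bv (e j) a) * π (xv a))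
          (fun q => π (bv q.1 q.2)) := by
        ext k
        rcases k with j | q
        · simp only [Φ, Sum.elim_inl, map_sum, map_mul]
        · simp only [Φ, Sum.elim_inr]
      rw [hk] at hind
      exact hind)
  refine ⟨P, hP0, ?_⟩
  intro B v lam mu hg hE hl
  let z : τ → ℂ := Sum.elim (fun q => B q.1 q.2) (Sum.elim v (Sum.elim lam mu))
  have hz : ∀ p, eval z (aeval xv p) = eval v p := by
    intro p
    induction p using MvPolynomial.induction_on with
    | C c => simp
    | add p q hp hq => simp [-aeval_eq_bind₁, hp, hq]
    | mul_X p i hp => simp [-aeval_eq_bind₁, hp, xv, z]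
  have := hP z (by
    intro p hp
    have hle : I ≤ RingHom.ker (eval z) := by
      rw [Ideal.span_le]
      rintro p ((⟨m, rfl⟩ | ⟨a, rfl⟩) | hp)
      · simp [-aeval_eq_bind₁, RingHom.mem_ker, E1, hz, hg]
      · simp [-aeval_eq_bind₁, RingHom.mem_ker, E2, hz, lv, bv, mv, z, hE]
      · rw [Set.mem_singleton_iff] at hp
        subst hp
        simp [-aeval_eq_bind₁, RingHom.mem_ker, lv, z, hl]
    exact hle hp)
  rw [← this]
  congr 1
  congr 1
  ext k
  rcases k with j | q <;> simp [-aeval_eq_bind₁, Φ, bv, xv, z]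

/-- Points of the variety of `g` where the first `k` rows of `B` are dependent modulo
the conormal space. -/
def Wset {n r : ℕ} (g : Fin r → MvPolynomial (Fin n) ℂ) (B : Fin n → Fin n → ℂ) (k : ℕ) :
    Set (Fin n → ℂ) :=
  {v | (∀ m, eval v (g m) = 0) ∧ ∃ lam : Fin n → ℂ, lam ≠ 0 ∧ (∀ j : Fin n, k ≤ (j : ℕ) → lam j = 0) ∧
    ∃ mu : Fin r → ℂ, ∀ a, ∑ j, lam j * B j a = ∑ m, mu m * eval v (pderiv a (g m))}

lemma eval_sumAlgEquiv {J K : Type} (P : MvPolynomial (J ⊕ K) ℂ) (y : J → ℂ) (B : K → ℂ) :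
    eval y (map (eval B) (sumAlgEquiv ℂ J K P)) = eval (Sum.elim y B) P := by
  induction P using MvPolynomial.induction_on with
  | C a => simp [sumAlgEquiv_C_inl]
  | add p q hp hq => simp [hp, hq]
  | mul_X p i hp =>
    rw [map_mul, map_mul, map_mul, hp]
    cases i <;> simp [sumAlgEquiv_X_inl, sumAlgEquiv_X_inr]

lemma sard_W {n r : ℕ} (g : Fin r → MvPolynomial (Fin n) ℂ) (k : ℕ) :
    ∃ P : MvPolynomial {j : Fin n // (j : ℕ) < k} (MvPolynomial (Fin n × Fin n) ℂ), P ≠ 0 ∧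
      ∀ (B : Fin n → Fin n → ℂ) (v : Fin n → ℂ), v ∈ Wset g B k →
        eval (fun j : {j : Fin n // (j : ℕ) < k} => ∑ a, B j.1 a * v a)
          (map (eval fun q : Fin n × Fin n => B q.1 q.2) P) = 0 := by
  classical
  choose P hP0 hP using fun l => sard_one g (J := {j : Fin n // (j : ℕ) < k}) Subtype.val l
  refine ⟨sumAlgEquiv ℂ _ _ (∏ l, P l), ?_, ?_⟩
  · simp only [ne_eq, EmbeddingLike.map_eq_zero_iff]
    exact Finset.prod_ne_zero_iff.2 fun l _ => hP0 l
  · rintro B v ⟨hv, lam, hlam, hlam0, mu, hmu⟩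
    rw [eval_sumAlgEquiv, map_prod]
    obtain ⟨l, hl⟩ : ∃ l, lam l ≠ 0 := by
      by_contra! h
      exact hlam (funext h)
    have hlk : (l : ℕ) < k := by
      by_contra! h
      exact hl (hlam0 l h)
    refine Finset.prod_eq_zero (Finset.mem_univ ⟨l, hlk⟩) ?_
    refine hP ⟨l, hlk⟩ B v (fun j => lam j.1 / lam l) (fun m => mu m / lam l) hv ?_ ?_
    · intro a
      have h1 : ∑ j : {j : Fin n // (j : ℕ) < k}, lam j.1 * B j.1 a = ∑ j, lam j * B j a := by
        rw [← Finset.sum_subtype (p := fun j : Fin n => (j : ℕ) < k)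
          (Finset.univ.filter fun j : Fin n => (j : ℕ) < k) (by simp) (fun j => lam j * B j a)]
        refine Finset.sum_subset (Finset.subset_univ _) ?_
        intro j _ hj
        rw [hlam0 j (by simpa using hj), zero_mul]
      have h2 := hmu a
      simp only [div_mul_eq_mul_div, ← Finset.sum_div]
      rw [h1, h2]
    · field_simp

lemma eval_smul_of_homog {J : Type} [Fintype J] {p : MvPolynomial J ℂ} {i : ℕ} (hp : p.IsHomogeneous i)
    (t : ℂ) (z : J → ℂ) : eval (t • z) p = t ^ i * eval z p := by
  rw [eval_eq, eval_eq, Finset.mul_sum]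
  refine Finset.sum_congr rfl fun d hd => ?_
  have : d.degree = i := hp.degree_eq_sum_deg_support hd |>.symm
  rw [← this, Finsupp.degree_apply]
  simp only [Pi.smul_apply, smul_eq_mul, mul_pow, Finset.prod_mul_distrib, Finset.prod_pow_eq_pow_sum]
  ring

lemma bdd_of_top {J : Type} [Fintype J] (p : MvPolynomial J ℂ) (D : ℕ) (hD : p.totalDegree ≤ D)
    (w : J → ℂ) (hw : eval w (homogeneousComponent D p) ≠ 0) (M : ℝ) :
    ∃ M' : ℝ, ∀ (y : J → ℂ) (t : ℂ), ‖y‖ ≤ M → eval (y + t • w) p = 0 → ‖t‖ ≤ M' := by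
  have hsum : p = ∑ i ∈ Finset.range (D + 1), homogeneousComponent i p := by
    conv_lhs => rw [← sum_homogeneousComponent p]
    refine Finset.sum_subset (by intro x; simp; omega) ?_
    intro x _ hx
    exact homogeneousComponent_eq_zero _ _ (by simpa using hx)
  let F : ℂ × (J → ℂ) → ℂ := fun q =>
    ∑ i ∈ Finset.range (D + 1), q.1 ^ (D - i) * eval (w + q.2) (homogeneousComponent i p)
  have hF : Continuous F := by
    refine continuous_finsetSum _ fun i _ => ?_
    refine Continuous.mul (by fun_prop) ?_
    exact (MvPolynomial.continuous_eval _).comp (by fun_prop)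
  have hF0 : F 0 ≠ 0 := by
    have : F 0 = eval w (homogeneousComponent D p) := by
      simp only [F, Prod.fst_zero, Prod.snd_zero, add_zero]
      rw [Finset.sum_eq_single D]
      · simp
      · intro b hb hbD
        have : D - b ≠ 0 := by have := Finset.mem_range.1 hb; omega
        simp [this]
      · simp
    rwa [this]
  have hnear := hF.continuousAt.eventually_ne hF0
  obtain ⟨δ, hδ, hball⟩ := Metric.eventually_nhds_iff.1 hnear
  refine ⟨max 1 ((|M| + 1) / δ), fun y t hy h => ?_⟩
  by_contra! ht
  have ht1 : (|M| + 1) / δ < ‖t‖ := lt_of_le_of_lt (le_max_right _ _) ht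
  have ht2 : 1 < ‖t‖ := lt_of_le_of_lt (le_max_left _ _) ht
  have ht0 : t ≠ 0 := by
    rintro rfl
    simp at ht2
    linarith
  have htp : 0 < ‖t‖ := by linarith
  have ht3 : |M| + 1 < ‖t‖ * δ := by rwa [div_lt_iff₀ hδ] at ht1
  refine hball (y := (t⁻¹, t⁻¹ • y)) ?_ ?_
  · rw [dist_zero_right, Prod.norm_def, max_lt_iff]
    simp only [norm_inv, norm_smul]
    constructor
    · rw [inv_lt_iff_one_lt_mul₀ htp]
      linarith [abs_nonneg M]
    · rw [inv_mul_lt_iff₀ htp]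
      linarith [le_abs_self M]
  · have h3 : eval (t • (w + t⁻¹ • y)) p = 0 := by
      rw [← h]
      congr 2
      rw [smul_add, smul_smul, mul_inv_cancel₀ ht0, one_smul, add_comm]
    rw [hsum, map_sum] at h3
    have h4 : F (t⁻¹, t⁻¹ • y) = (t⁻¹) ^ D * ∑ i ∈ Finset.range (D + 1),
        eval (t • (w + t⁻¹ • y)) (homogeneousComponent i p) := by
      rw [Finset.mul_sum]
      refine Finset.sum_congr rfl fun i hi => ?_
      rw [eval_smul_of_homog (homogeneousComponent_isHomogeneous i p), ← mul_assoc]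
      congr 1
      have : D = (D - i) + i := by have := Finset.mem_range.1 hi; omega
      conv_rhs => rw [this, pow_add, mul_assoc, ← mul_pow, inv_mul_cancel₀ ht0, one_pow, mul_one]
    rw [h4, h3, mul_zero]

lemma homogeneousComponent_totalDegree_ne_zero {J R : Type} [CommRing R] {P : MvPolynomial J R}
    (hP : P ≠ 0) : homogeneousComponent P.totalDegree P ≠ 0 := by
  obtain ⟨d, hd, hdeg⟩ := Finset.exists_mem_eq_sup P.support (support_nonempty.2 hP)
    (fun s => s.sum fun _ e => e)
  intro h
  have h1 := congrArg (coeff d) h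
  rw [coeff_homogeneousComponent, if_pos, coeff_zero] at h1
  · exact (mem_support_iff.1 hd) h1
  · rw [MvPolynomial.totalDegree, hdeg]; rfl

lemma totalDegree_map_le' {J R S : Type} [CommRing R] [CommRing S] (f : R →+* S)
    (P : MvPolynomial J R) : (map f P).totalDegree ≤ P.totalDegree :=
  Finset.sup_mono (support_map_subset f P)

lemma homogeneousComponent_map' {J R S : Type} [CommRing R] [CommRing S] (f : R →+* S)
    (P : MvPolynomial J R) (D : ℕ) :
    homogeneousComponent D (map f P) = map f (homogeneousComponent D P) := by
  ext d
  rw [coeff_homogeneousComponent, coeff_map, coeff_map, coeff_homogeneousComponent]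
  split_ifs <;> simp

lemma eval_map_eval {J K : Type} (P : MvPolynomial J (MvPolynomial K ℂ)) (w : J → ℂ) (B : K → ℂ) :
    eval w (map (eval B) P) = eval B (eval (fun j => C (w j)) P) := by
  induction P using MvPolynomial.induction_on with
  | C a => simp
  | add p q hp hq => simp [hp, hq]
  | mul_X p i hp => simp [hp]

lemma eval_aeval_subst {J K : Type} (P : MvPolynomial J ℂ) (u : J → MvPolynomial K ℂ) (B : K → ℂ) :
    eval B (aeval u P) = eval (fun q => eval B (u q)) P := by
  induction P using MvPolynomial.induction_on with
  | C a => simp [-aeval_eq_bind₁, algebraMap_eq]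
  | add p q hp hq => rw [map_add, map_add, map_add, hp, hq]
  | mul_X p i hp => rw [map_mul, map_mul, map_mul, hp, aeval_X, eval_X]

lemma exists_eval_ne {J : Type} {P : MvPolynomial J ℂ} (hP : P ≠ 0) : ∃ x, eval x P ≠ 0 := by
  by_contra! h
  exact hP (MvPolynomial.funext fun x => by simp [h x])

lemma exists_top_point {J K : Type} [Fintype J] {P : MvPolynomial J (MvPolynomial K ℂ)} {D : ℕ}
    (hP : P ≠ 0) (hh : P.IsHomogeneous D) (i0 : J) :
    ∃ (w : J → ℂ) (B : K → ℂ), w i0 = 1 ∧ eval w (map (eval B) P) ≠ 0 := by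
  obtain ⟨x, hx⟩ := exists_eval_ne (P := (sumAlgEquiv ℂ J K).symm (P * X i0)) (by
    simp only [ne_eq, EmbeddingLike.map_eq_zero_iff]
    exact mul_ne_zero hP (X_ne_zero _))
  have hx' : x = Sum.elim (x ∘ Sum.inl) (x ∘ Sum.inr) := by simp
  rw [hx', ← eval_sumAlgEquiv, AlgEquiv.apply_symm_apply, map_mul, map_mul, map_X, eval_X] at hx
  have h1 := left_ne_zero_of_mul hx
  have h2 := right_ne_zero_of_mul hx
  refine ⟨((x ∘ Sum.inl) i0)⁻¹ • (x ∘ Sum.inl), x ∘ Sum.inr, ?_, ?_⟩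
  · simpa using inv_mul_cancel₀ h2
  · rw [eval_smul_of_homog (hh.map _)]
    exact mul_ne_zero (pow_ne_zero _ (inv_ne_zero h2)) h1

/-- Boundedness claim proved by descending induction. -/
def BddClaim {n r : ℕ} (g : Fin r → MvPolynomial (Fin n) ℂ) (k : ℕ) : Prop :=
  ∃ Q : MvPolynomial (Fin n × Fin n) ℂ, Q ≠ 0 ∧ ∀ B : Fin n → Fin n → ℂ,
    eval (fun q => B q.1 q.2) Q ≠ 0 → ∀ S : Set (Fin n → ℂ),
      (k < n → S ⊆ Wset g B (k + 1)) →
      (∀ j : Fin n, (j : ℕ) < k → ∃ M : ℝ, ∀ v ∈ S, ‖∑ a, B j a * v a‖ ≤ M) →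
      Bornology.IsBounded S

lemma bddClaim_top {n r : ℕ} (g : Fin r → MvPolynomial (Fin n) ℂ) : BddClaim g n := by
  refine ⟨Matrix.det (Matrix.mvPolynomialX (Fin n) (Fin n) ℂ), Matrix.det_mvPolynomialX_ne_zero _ _,
    fun B hB S _ hM => ?_⟩
  rw [Matrix.eval_det_mvPolynomialX] at hB
  set B' : Matrix (Fin n) (Fin n) ℂ := Matrix.of fun i j => B i j with hB'
  choose M hM using fun j => hM j j.2
  have hc : IsCompact (Set.pi Set.univ fun j => Metric.closedBall (0 : ℂ) (M j)) :=
    isCompact_univ_pi fun j => isCompact_closedBall _ _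
  have hcont : Continuous fun v : Fin n → ℂ => B'⁻¹.mulVec v := by fun_prop
  refine (hc.image hcont).isBounded.subset ?_
  intro v hv
  refine ⟨B'.mulVec v, ?_, ?_⟩
  · intro j _
    simpa [Matrix.mulVec, dotProduct, hB'] using hM j v hv
  · simp only [Matrix.mulVec_mulVec]
    rw [Matrix.nonsing_inv_mul _ (isUnit_iff_ne_zero.2 hB), Matrix.one_mulVec]

lemma Wset_mono {n r : ℕ} (g : Fin r → MvPolynomial (Fin n) ℂ) (B : Fin n → Fin n → ℂ) (k : ℕ) :
    Wset g B k ⊆ Wset g B (k + 1) := by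
  rintro v ⟨hv, lam, h0, h1, h2⟩
  exact ⟨hv, lam, h0, fun j hj => h1 j (by omega), h2⟩

lemma Wset_shear {n r : ℕ} (g : Fin r → MvPolynomial (Fin n) ℂ) (B : Fin n → Fin n → ℂ)
    (i0 : Fin n) (c : Fin n → ℂ) (hc : c i0 = 0) :
    Wset g B (i0 + 1) ⊆ Wset g (fun j a => B j a + c j * B i0 a) (i0 + 1) := by
  rintro v ⟨hv, lam, h0, h1, mu, h2⟩
  set σ := ∑ j, lam j * c j with hσ
  refine ⟨hv, fun j => lam j - if j = i0 then σ else 0, ?_, ?_, mu, ?_⟩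
  · intro h
    have h3 : ∀ j, lam j = if j = i0 then σ else 0 := fun j => by
      have := congrFun h j
      simpa [sub_eq_zero] using this
    have h4 : σ = 0 := by
      rw [hσ]
      refine Finset.sum_eq_zero fun j _ => ?_
      rw [h3 j]
      split_ifs with hj
      · rw [hj, hc, mul_zero]
      · rw [zero_mul]
    apply h0
    funext j
    rw [h3 j, h4]; simp
  · intro j hj
    have : j ≠ i0 := by rintro rfl; omega
    simp [h1 j hj, this]
  · intro a
    rw [← h2 a]
    have : ∀ j, (lam j - if j = i0 then σ else 0) * (B j a + c j * B i0 a)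
      = lam j * B j a + lam j * c j * B i0 a - (if j = i0 then σ * (B j a + c j * B i0 a) else 0) := by
      intro j
      split_ifs <;> ring
    simp only [this, Finset.sum_sub_distrib, Finset.sum_add_distrib, ← Finset.sum_mul, ← hσ,
      Finset.sum_ite_eq', Finset.mem_univ, if_true, hc]
    ring

lemma bddClaim_step {n r : ℕ} (g : Fin r → MvPolynomial (Fin n) ℂ) (k : ℕ) (hk : k < n)
    (h : BddClaim g (k + 1)) : BddClaim g k := by
  classical
  obtain ⟨Q, hQ0, hQ⟩ := h
  obtain ⟨P, hP0, hP⟩ := sard_W g (k + 1)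
  set i0 : Fin n := ⟨k, hk⟩ with hi0
  have hi0' : (i0 : ℕ) < k + 1 := by simp [hi0]
  have hPD := homogeneousComponent_totalDegree_ne_zero hP0
  set PD := homogeneousComponent P.totalDegree P with hPDdef
  obtain ⟨w, B0, hw1, hB0⟩ := exists_top_point (i0 := ⟨i0, hi0'⟩) hPD
    (homogeneousComponent_isHomogeneous _ _)
  let c : Fin n → ℂ := fun j => if hj : (j : ℕ) < k then w ⟨j, by omega⟩ else 0
  have hc0 : c i0 = 0 := by simp [c, hi0]
  let u : Fin n × Fin n → MvPolynomial (Fin n × Fin n) ℂ := fun q => X q + C (c q.1) * X (i0, q.2)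
  let R : MvPolynomial (Fin n × Fin n) ℂ := eval (fun j => C (w j)) PD
  have hevu : ∀ B : Fin n → Fin n → ℂ, eval (fun q => B q.1 q.2) (aeval u R) =
      eval w (map (eval fun q : Fin n × Fin n => B q.1 q.2 + c q.1 * B i0 q.2) PD) := by
    intro B
    rw [eval_aeval_subst, eval_map_eval]
    simp [u, R]
  refine ⟨Q * aeval u R, mul_ne_zero hQ0 ?_, fun B hB S hS hM => ?_⟩
  · intro h0
    have h1 := hevu (fun j a => B0 (j, a) - c j * B0 (i0, a))
    rw [h0, map_zero] at h1
    apply hB0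
    rw [h1]
    congr 4
    funext q
    simp [hc0]
  · rw [map_mul] at hB
    have hBQ := left_ne_zero_of_mul hB
    have hBR := right_ne_zero_of_mul hB
    rw [hevu] at hBR
    have hSW := hS hk
    refine hQ B hBQ S (fun _ => hSW.trans (Wset_mono g B (k + 1))) ?_
    intro j hj
    by_cases hjk : (j : ℕ) < k
    · exact hM j hjk
    have hji : j = i0 := Fin.ext (by simp [hi0]; omega)
    subst hji
    choose! M hM using hM
    let UB : Fin n → Fin n → ℂ := fun j a => B j a + c j * B i0 a
    obtain ⟨M', hM'⟩ := bdd_of_top (map (eval fun q : Fin n × Fin n => UB q.1 q.2) P) P.totalDegree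
      (totalDegree_map_le' _ _) w (by rw [homogeneousComponent_map']; exact hBR) (∑ j, |M j|)
    refine ⟨M', fun v hv => ?_⟩
    have hvW : v ∈ Wset g UB (k + 1) := Wset_shear g B i0 c hc0 (hSW hv)
    have hz := hP UB v hvW
    refine hM' (fun j => if (j.1 : ℕ) < k then ∑ a, B j.1 a * v a else 0) _ ?_ ?_
    · rw [pi_norm_le_iff_of_nonneg (Finset.sum_nonneg fun j _ => abs_nonneg _)]
      intro j
      split_ifs with hjk'
      · refine (hM j.1 hjk' v hv).trans ((le_abs_self _).trans ?_)
        exact Finset.single_le_sum (f := fun j => |M j|) (fun j _ => abs_nonneg _)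
          (Finset.mem_univ j.1)
      · simpa using Finset.sum_nonneg fun j _ => abs_nonneg (M j)
    · refine Eq.trans ?_ hz
      congr 2
      funext j
      have hUBv : ∑ a, UB j.1 a * v a = ∑ a, B j.1 a * v a + c j.1 * ∑ a, B i0 a * v a := by
        simp only [UB, add_mul, Finset.sum_add_distrib, Finset.mul_sum, mul_assoc]
      rw [hUBv]
      simp only [Pi.add_apply, Pi.smul_apply, smul_eq_mul]
      split_ifs with hjk'
      · simp only [c, hjk', dif_pos]
        ring
      · have hj0 : j = ⟨i0, hi0'⟩ := Subtype.ext (Fin.ext (by simp [hi0]; omega))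
        subst hj0
        rw [hw1, hc0]; ring

lemma bddClaim {n r : ℕ} (g : Fin r → MvPolynomial (Fin n) ℂ) (k : ℕ) (hk : k ≤ n) :
    BddClaim g k := by
  induction hk using Nat.decreasingInduction with
  | self => exact bddClaim_top g
  | of_succ k hk ih => exact bddClaim_step g k hk ih

lemma inv_poly {n : ℕ} (Q : MvPolynomial (Fin n × Fin n) ℂ) :
    ∃ (N : ℕ) (Q' : MvPolynomial (Fin n × Fin n) ℂ), ∀ A : Matrix (Fin n) (Fin n) ℂ, A.det ≠ 0 →
      eval (fun q => A q.1 q.2) Q' = A.det ^ N * eval (fun q => A⁻¹ q.1 q.2) Q := by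
  have hdet : ∀ A : Matrix (Fin n) (Fin n) ℂ, eval (fun q => A q.1 q.2)
      (Matrix.mvPolynomialX (Fin n) (Fin n) ℂ).det = A.det := by
    intro A
    rw [Matrix.eval_det_mvPolynomialX]
    rfl
  induction Q using MvPolynomial.induction_on with
  | C a => exact ⟨0, C a, fun A _ => by simp⟩
  | add p q hp hq =>
    obtain ⟨N1, Q1, h1⟩ := hp
    obtain ⟨N2, Q2, h2⟩ := hq
    refine ⟨N1 + N2, Q1 * (Matrix.mvPolynomialX (Fin n) (Fin n) ℂ).det ^ N2 +
      Q2 * (Matrix.mvPolynomialX (Fin n) (Fin n) ℂ).det ^ N1, fun A hA => ?_⟩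
    simp only [map_add, map_mul, map_pow, hdet, h1 A hA, h2 A hA]
    ring
  | mul_X p i hp =>
    obtain ⟨N1, Q1, h1⟩ := hp
    refine ⟨N1 + 1, Q1 * (Matrix.mvPolynomialX (Fin n) (Fin n) ℂ).adjugate i.1 i.2, fun A hA => ?_⟩
    have hadj : eval (fun q => A q.1 q.2)
        ((Matrix.mvPolynomialX (Fin n) (Fin n) ℂ).adjugate i.1 i.2) = A.adjugate i.1 i.2 := by
      have h := RingHom.map_adjugate (eval fun q : Fin n × Fin n => A q.1 q.2)
        (Matrix.mvPolynomialX (Fin n) (Fin n) ℂ)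
      rw [Matrix.mvPolynomialX_mapMatrix_eval] at h
      exact congrFun (congrFun h i.1) i.2
    rw [map_mul, hadj, h1 A hA, map_mul, eval_X, Matrix.inv_def]
    simp only [Matrix.smul_apply, smul_eq_mul, Ring.inverse_eq_inv']
    field_simp
    ring

/-- The first `i` rows of `B` as a linear map. -/
def rowMap {n : ℕ} (B : Fin n → Fin n → ℂ) (i : ℕ) (hi : i ≤ n) :
    (Fin n → ℂ) →ₗ[ℂ] (Fin i → ℂ) :=
  LinearMap.pi fun k => ∑ a, B (Fin.castLE hi k) a • LinearMap.proj a

/-- The differentials of the `g m` at `v`. -/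
def dmap {n r : ℕ} (g : Fin r → MvPolynomial (Fin n) ℂ) (v : Fin n → ℂ) :
    (Fin n → ℂ) →ₗ[ℂ] (Fin r → ℂ) :=
  LinearMap.pi fun m => ∑ a, eval v (pderiv a (g m)) • LinearMap.proj a

lemma rowMap_apply {n : ℕ} (B : Fin n → Fin n → ℂ) (i : ℕ) (hi : i ≤ n) (t : Fin n → ℂ)
    (k : Fin i) : rowMap B i hi t k = ∑ a, B (Fin.castLE hi k) a * t a := by
  simp [rowMap]

lemma dmap_apply {n r : ℕ} (g : Fin r → MvPolynomial (Fin n) ℂ) (v t : Fin n → ℂ)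
    (m : Fin r) : dmap g v t m = polyDiff v (g m) t := by
  simp [dmap, polyDiff, mul_comm]

lemma tangentAt_eq_ker {n r : ℕ} (V : Set (Fin n → ℂ)) (g : Fin r → MvPolynomial (Fin n) ℂ)
    (hg : Ideal.span (Set.range g) = vIdeal V) (v : Fin n → ℂ) (hv : v ∈ V) :
    tangentAt V v = LinearMap.ker (dmap g v) := by
  ext t
  rw [LinearMap.mem_ker]
  constructor
  · intro ht
    funext m
    rw [dmap_apply]
    exact ht (g m) (hg ▸ Ideal.subset_span ⟨m, rfl⟩)
  · intro ht q hq
    rw [← hg] at hq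
    induction hq using Submodule.span_induction with
    | mem x hx =>
      obtain ⟨m, rfl⟩ := hx
      rw [← dmap_apply, ht]; rfl
    | zero => simp [polyDiff]
    | add x y _ _ hx hy =>
      simp only [polyDiff, map_add, mul_add, Finset.sum_add_distrib] at *
      rw [hx, hy, add_zero]
    | smul a x hxs hx =>
      have hx0 : eval v x = 0 := by
        have : x ∈ vIdeal V := hg ▸ hxs
        exact this v hv
      simp only [polyDiff, smul_eq_mul, Derivation.leibniz, map_add, map_mul, hx0, zero_mul,
        add_zero] at *
      calc _ = eval v a * ∑ j, t j * eval v (pderiv j x) := by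
            rw [Finset.mul_sum]; exact Finset.sum_congr rfl fun j _ => by ring
        _ = 0 := by rw [hx, mul_zero]

/-- The points where the first `i` rows of `B` are not surjective on the tangent space. -/
def critB {n : ℕ} (V : Set (Fin n → ℂ)) (B : Fin n → Fin n → ℂ) (i : ℕ) (hi : i ≤ n) :
    Set (Fin n → ℂ) :=
  {v | v ∈ V ∧ (tangentAt V v).map (rowMap B i hi) ≠ ⊤}

lemma critB_subset_Wset {n r : ℕ} (V : Set (Fin n → ℂ)) (g : Fin r → MvPolynomial (Fin n) ℂ)
    (hg : Ideal.span (Set.range g) = vIdeal V) (B : Fin n → Fin n → ℂ) (i : ℕ) (hi : i ≤ n) :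
    critB V B i hi ⊆ Wset g B i := by
  classical
  rintro v ⟨hv, hvc⟩
  have hgm : ∀ m, g m ∈ vIdeal V := fun m => hg ▸ Ideal.subset_span ⟨m, rfl⟩
  refine ⟨fun m => hgm m v hv, ?_⟩
  obtain ⟨f, hf0, hf⟩ := Submodule.exists_le_ker_of_lt_top _ (lt_top_iff_ne_top.2 hvc)
  let lam : Fin n → ℂ := fun j => if h : (j : ℕ) < i then f (Pi.single ⟨j, h⟩ 1) else 0
  have hfx : ∀ t, f (rowMap B i hi t) = ∑ j, lam j * ∑ a, B j a * t a := by
    intro t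
    have h1 : f (rowMap B i hi t) = ∑ k : Fin i, rowMap B i hi t k * f (Pi.single k 1) := by
      conv_lhs => rw [← (Pi.basisFun ℂ (Fin i)).sum_repr (rowMap B i hi t)]
      simp
    rw [h1]
    symm
    have h2 : ∑ k : Fin i, rowMap B i hi t k * f (Pi.single k 1) =
      ∑ k : Fin i, lam (Fin.castLE hi k) * ∑ a, B (Fin.castLE hi k) a * t a := by
      refine Finset.sum_congr rfl fun k _ => ?_
      rw [rowMap_apply]
      simp [lam, mul_comm]
    rw [h2]
    refine Eq.trans ?_ (Finset.sum_map Finset.univ (Fin.castLEEmb hi)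
      (fun j => lam j * ∑ a, B j a * t a))
    symm
    refine Finset.sum_subset (Finset.subset_univ _) ?_
    intro j _ hj
    have : ¬ (j : ℕ) < i := by
      intro hji
      exact hj (Finset.mem_map.2 ⟨⟨j, hji⟩, Finset.mem_univ _, rfl⟩)
    simp [lam, this]
  refine ⟨lam, ?_, ?_, ?_⟩
  · intro h0
    apply hf0
    refine (Pi.basisFun ℂ (Fin i)).ext fun k => ?_
    have := congrFun h0 (Fin.castLE hi k)
    simpa [lam] using this
  · intro j hj
    simp [lam, not_lt.2 hj]
  · have hmem := mem_span_of_iInf_ker_le_ker (𝕜 := ℂ)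
      (L := fun m => (LinearMap.proj m).comp (dmap g v)) (K := f.comp (rowMap B i hi)) (by
        intro t ht
        simp only [Submodule.mem_iInf, LinearMap.mem_ker, LinearMap.comp_apply,
          LinearMap.proj_apply] at ht
        have ht' : t ∈ tangentAt V v := by
          rw [tangentAt_eq_ker V g hg v hv, LinearMap.mem_ker]
          exact funext ht
        exact hf ⟨t, ht', rfl⟩)
    obtain ⟨mu, hmu⟩ := (Submodule.mem_span_range_iff_exists_fun ℂ).1 hmem
    refine ⟨mu, fun a => ?_⟩
    have h := LinearMap.congr_fun hmu (Pi.single a 1)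
    simp only [LinearMap.comp_apply, hfx] at h
    simp [dmap_apply, polyDiff, Pi.single_apply] at h
    exact h.symm

lemma subset_critB {n d : ℕ} (V : Set (Fin n → ℂ)) (hs : singLocus V d = ∅)
    (B : Fin n → Fin n → ℂ) (hi : d + 1 ≤ n) : V ⊆ critB V B (d + 1) hi := by
  intro v hv
  refine ⟨hv, fun h => ?_⟩
  have hd : Module.finrank ℂ (tangentAt V v) = d := by
    by_contra h
    have : v ∈ singLocus V d := ⟨hv, h⟩
    simp [hs] at this
  have h1 := Submodule.finrank_map_le (rowMap B (d + 1) hi) (tangentAt V v)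
  rw [h, hd, finrank_top] at h1
  simp at h1

lemma isClosed_critB {n r d : ℕ} (V : Set (Fin n → ℂ)) (hVc : IsClosed V)
    (hs : singLocus V d = ∅) (g : Fin r → MvPolynomial (Fin n) ℂ)
    (hg : Ideal.span (Set.range g) = vIdeal V) (B : Fin n → Fin n → ℂ) (i : ℕ) (hi : i ≤ n) :
    IsClosed (critB V B i hi) := by
  let N : (Fin n → ℂ) → (Fin n → ℂ) →L[ℂ] ((Fin r → ℂ) × (Fin i → ℂ)) := fun v =>
    LinearMap.toContinuousLinearMap ((dmap g v).prod (rowMap B i hi))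
  have hN : Continuous N := by
    rw [continuous_clm_apply]
    intro t
    refine Continuous.prodMk ?_ continuous_const
    refine continuous_pi fun m => ?_
    change Continuous fun v => dmap g v t m
    simp only [dmap_apply, polyDiff]
    refine continuous_finsetSum _ fun j _ => ?_
    exact continuous_const.mul (MvPolynomial.continuous_eval _)
  have key : critB V B i hi = V ∩ {v |
      ((n - d + i : ℕ) : Cardinal) ≤ (N v : (Fin n → ℂ) →ₗ[ℂ] ((Fin r → ℂ) × (Fin i → ℂ))).rank}ᶜ := by
    ext v
    simp only [critB, Set.mem_ofPred_eq, Set.mem_inter_iff, Set.mem_compl_iff, ne_eq]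
    refine and_congr_right fun hv => not_congr ?_
    have hd : Module.finrank ℂ (tangentAt V v) = d := by
      by_contra h
      have : v ∈ singLocus V d := ⟨hv, h⟩
      simp [hs] at this
    have hdn : d ≤ n := by
      have := Submodule.finrank_le (tangentAt V v)
      rw [hd] at this
      simpa using this
    set T := tangentAt V v with hT
    have hTk : T = LinearMap.ker (dmap g v) := tangentAt_eq_ker V g hg v hv
    let L : T →ₗ[ℂ] (Fin i → ℂ) := (rowMap B i hi).domRestrict T
    have hmapr : T.map (rowMap B i hi) = LinearMap.range L := by
      rw [LinearMap.range_domRestrict]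
    have h1 := LinearMap.finrank_range_add_finrank_ker L
    have h2 := LinearMap.finrank_range_add_finrank_ker ((dmap g v).prod (rowMap B i hi))
    have h3 : Module.finrank ℂ (LinearMap.ker L) =
        Module.finrank ℂ (LinearMap.ker ((dmap g v).prod (rowMap B i hi))) := by
      rw [LinearMap.ker_prod, ← hTk, LinearMap.ker_domRestrict]
      rw [← Submodule.map_comap_subtype, Submodule.finrank_map_subtype_eq]
    have h4 : (N v : (Fin n → ℂ) →ₗ[ℂ] ((Fin r → ℂ) × (Fin i → ℂ))).rank =
      ((Module.finrank ℂ (LinearMap.range ((dmap g v).prod (rowMap B i hi))) : ℕ) : Cardinal) := by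
      rw [Module.finrank_eq_rank]; rfl
    rw [h4, Nat.cast_le, hmapr]
    rw [hd] at h1
    simp only [Module.finrank_fintype_fun_eq_card, Fintype.card_fin] at h2
    have h5 := Submodule.finrank_le (LinearMap.range L)
    simp only [Module.finrank_fintype_fun_eq_card, Fintype.card_fin] at h5
    constructor
    · intro h
      rw [h, finrank_top] at h1
      simp at h1
      omega
    · intro h
      apply Submodule.eq_top_of_finrank_eq
      simp
      omega
  rw [key]
  refine hVc.inter (IsOpen.isClosed_compl ?_)
  exact (isOpen_setOfPred_nat_le_rank _).preimage hN

/-- Linear substitution in a polynomial. -/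
def linSubst {n : ℕ} (M : Matrix (Fin n) (Fin n) ℂ) (q : MvPolynomial (Fin n) ℂ) :
    MvPolynomial (Fin n) ℂ :=
  aeval (fun j => ∑ k, C (M j k) * X k) q

lemma eval_linSubst {n : ℕ} (M : Matrix (Fin n) (Fin n) ℂ) (q : MvPolynomial (Fin n) ℂ)
    (x : Fin n → ℂ) : eval x (linSubst M q) = eval (M.mulVec x) q := by
  induction q using MvPolynomial.induction_on with
  | C a => simp [linSubst, -aeval_eq_bind₁, algebraMap_eq]
  | add p q hp hq =>
    simp only [linSubst, map_add] at *
    rw [hp, hq]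
  | mul_X p i hp =>
    simp only [linSubst, map_mul, aeval_X, eval_X] at *
    rw [hp]
    simp [Matrix.mulVec, dotProduct]

lemma polyDiff_mul {n : ℕ} (x t : Fin n → ℂ) (p q : MvPolynomial (Fin n) ℂ) :
    polyDiff x (p * q) t = eval x p * polyDiff x q t + eval x q * polyDiff x p t := by
  simp only [polyDiff, Derivation.leibniz, map_add, smul_eq_mul, map_mul, Finset.mul_sum,
    ← Finset.sum_add_distrib]
  exact Finset.sum_congr rfl fun j _ => by ring

lemma polyDiff_add {n : ℕ} (x t : Fin n → ℂ) (p q : MvPolynomial (Fin n) ℂ) :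
    polyDiff x (p + q) t = polyDiff x p t + polyDiff x q t := by
  simp only [polyDiff, map_add, mul_add, Finset.sum_add_distrib]

lemma polyDiff_X {n : ℕ} (x t : Fin n → ℂ) (j : Fin n) :
    polyDiff x (X j) t = t j := by
  simp [polyDiff, pderiv_X, Pi.single_apply, apply_ite]

lemma polyDiff_linSubst {n : ℕ} (M : Matrix (Fin n) (Fin n) ℂ) (q : MvPolynomial (Fin n) ℂ)
    (x t : Fin n → ℂ) : polyDiff x (linSubst M q) t = polyDiff (M.mulVec x) q (M.mulVec t) := by
  induction q using MvPolynomial.induction_on with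
  | C a => simp [linSubst, polyDiff, -aeval_eq_bind₁, algebraMap_eq]
  | add p q hp hq =>
    rw [polyDiff_add, ← hp, ← hq, ← polyDiff_add]
    simp only [linSubst, map_add]
  | mul_X p i hp =>
    have h1 : linSubst M (p * X i) = linSubst M p * linSubst M (X i) := by simp only [linSubst, map_mul]
    have h2 : polyDiff x (linSubst M (X i)) t = M.mulVec t i := by
      simp only [linSubst, aeval_X, polyDiff, map_sum, Matrix.mulVec, dotProduct]
      refine Finset.sum_congr rfl fun j _ => ?_
      simp [pderiv_X, Pi.single_apply, apply_ite, mul_comm]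
    rw [h1, polyDiff_mul, polyDiff_mul, hp, h2, eval_linSubst, eval_linSubst, polyDiff_X]

lemma tangent_image {n : ℕ} (M : Matrix (Fin n) (Fin n) ℂ) (Y : Set (Fin n → ℂ)) (x t : Fin n → ℂ)
    (ht : t ∈ tangentAt Y x) :
    M.mulVec t ∈ tangentAt ((fun v => M.mulVec v) '' Y) (M.mulVec x) := by
  intro q hq
  rw [← polyDiff_linSubst]
  refine ht _ ?_
  intro y hy
  rw [eval_linSubst]
  exact hq _ ⟨y, hy, rfl⟩

lemma mem_image_inv {n : ℕ} (A : Matrix (Fin n) (Fin n) ℂ) (hA : IsUnit A.det)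
    (V : Set (Fin n → ℂ)) (p : Fin n → ℂ) :
    p ∈ (fun v => A⁻¹.mulVec v) '' V ↔ A.mulVec p ∈ V := by
  constructor
  · rintro ⟨v, hv, rfl⟩
    simpa [Matrix.mulVec_mulVec, Matrix.mul_nonsing_inv _ hA] using hv
  · intro h
    exact ⟨_, h, by simp [Matrix.mulVec_mulVec, Matrix.nonsing_inv_mul _ hA]⟩

lemma image_image_inv {n : ℕ} (A : Matrix (Fin n) (Fin n) ℂ) (hA : IsUnit A.det)
    (V : Set (Fin n → ℂ)) :
     (fun v => A.mulVec v) '' ((fun v => A⁻¹.mulVec v) '' V) = V := by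
  rw [Set.image_image]
  simp [Matrix.mulVec_mulVec, Matrix.mul_nonsing_inv _ hA]

lemma mem_tangent_inv {n : ℕ} (A : Matrix (Fin n) (Fin n) ℂ) (hA : IsUnit A.det)
    (V : Set (Fin n → ℂ)) (p t : Fin n → ℂ) :
    t ∈ tangentAt ((fun v => A⁻¹.mulVec v) '' V) p ↔ A.mulVec t ∈ tangentAt V (A.mulVec p) := by
  constructor
  · intro h
    have := tangent_image A _ p t h
    rwa [image_image_inv A hA] at this
  · intro h
    have := tangent_image A⁻¹ _ _ _ h
    simpa [Matrix.mulVec_mulVec, Matrix.nonsing_inv_mul _ hA] using this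

lemma tangent_map_eq {n : ℕ} (A : Matrix (Fin n) (Fin n) ℂ) (hA : IsUnit A.det)
    (V : Set (Fin n → ℂ)) (p : Fin n → ℂ) :
    tangentAt ((fun v => A⁻¹.mulVec v) '' V) p =
      (tangentAt V (A.mulVec p)).map A⁻¹.mulVecLin := by
  ext t
  rw [mem_tangent_inv A hA, Submodule.mem_map]
  constructor
  · intro h
    exact ⟨_, h, by simp [Matrix.mulVec_mulVec, Matrix.nonsing_inv_mul _ hA]⟩
  · rintro ⟨y, hy, rfl⟩
    simpa [Matrix.mulVec_mulVec, Matrix.mul_nonsing_inv _ hA] using hy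

lemma finrank_tangent {n : ℕ} (A : Matrix (Fin n) (Fin n) ℂ) (hA : IsUnit A.det)
    (V : Set (Fin n → ℂ)) (p : Fin n → ℂ) :
    Module.finrank ℂ (tangentAt ((fun v => A⁻¹.mulVec v) '' V) p) =
      Module.finrank ℂ (tangentAt V (A.mulVec p)) := by
  rw [tangent_map_eq A hA]
  refine (Submodule.equivMapOfInjective _ ?_ _).finrank_eq.symm
  intro x y hxy
  have := congrArg A.mulVec hxy
  simpa [Matrix.mulVec_mulVec, Matrix.mul_nonsing_inv _ hA] using this

lemma singLocus_inv {n : ℕ} (A : Matrix (Fin n) (Fin n) ℂ) (hA : IsUnit A.det)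
    (V : Set (Fin n → ℂ)) (d : ℕ) (hs : singLocus V d = ∅) :
    singLocus ((fun v => A⁻¹.mulVec v) '' V) d = ∅ := by
  rw [Set.eq_empty_iff_forall_notMem] at hs ⊢
  rintro p ⟨hp, hf⟩
  refine hs (A.mulVec p) ⟨(mem_image_inv A hA V p).1 hp, ?_⟩
  rwa [finrank_tangent A hA] at hf

lemma critMap_inv {n : ℕ} (A : Matrix (Fin n) (Fin n) ℂ) (hA : IsUnit A.det)
    (V : Set (Fin n → ℂ)) (d : ℕ) (hs : singLocus V d = ∅) (i : ℕ) (hi : i ≤ n) :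
    critMap ((fun v => A⁻¹.mulVec v) '' V) d (projPoly n i) =
      (fun p => A.mulVec p) ⁻¹' critB V (fun j a => A⁻¹ j a) i hi := by
  ext p
  simp only [critMap, critB, Set.mem_ofPred_eq, Set.mem_preimage, singLocus_inv A hA V d hs,
    mem_image_inv A hA, Set.mem_empty_iff_false, not_false_eq_true, true_and]
  refine and_congr_right fun hp => not_congr ?_
  have hproj : ∀ (t : Fin n → ℂ) (k : Fin i), polyDiff p (projPoly n i k) t = t (Fin.castLE hi k) := by
    intro t k
    have : (k : ℕ) < n := by omega
    simp only [projPoly, this, dif_pos, polyDiff_X]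
    rfl
  have hrow : ∀ t : Fin n → ℂ, rowMap (fun j a => A⁻¹ j a) i hi (A.mulVec t) = fun k => t (Fin.castLE hi k) := by
    intro t
    funext k
    rw [rowMap_apply]
    have : A⁻¹.mulVec (A.mulVec t) = t := by
      simp [Matrix.mulVec_mulVec, Matrix.nonsing_inv_mul _ hA]
    exact congrFun this (Fin.castLE hi k)
  rw [eq_top_iff]
  constructor
  · intro h y _
    obtain ⟨t, ht⟩ := h y
    refine ⟨A.mulVec t, (mem_tangent_inv A hA V p t).1 t.2, ?_⟩
    rw [hrow, ← ht]
    funext k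
    exact (hproj _ _).symm
  · intro h y
    obtain ⟨t, ht, hty⟩ := h (Submodule.mem_top (x := y))
    have htt : A.mulVec (A⁻¹.mulVec t) = t := by
      simp [Matrix.mulVec_mulVec, Matrix.mul_nonsing_inv _ hA]
    refine ⟨⟨A⁻¹.mulVec t, (mem_tangent_inv A hA V p _).2 (by rwa [htt])⟩, ?_⟩
    rw [← hty]
    conv_rhs => rw [← htt, hrow]
    funext k
    exact hproj _ _

lemma proper_of_claim {n r : ℕ} (A : Matrix (Fin n) (Fin n) ℂ) (hA : IsUnit A.det)
    (g : Fin r → MvPolynomial (Fin n) ℂ) (k : ℕ) (hk : k ≤ n)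
    (Q : MvPolynomial (Fin n × Fin n) ℂ)
    (hQ : ∀ B : Fin n → Fin n → ℂ,
      eval (fun q => B q.1 q.2) Q ≠ 0 → ∀ S : Set (Fin n → ℂ),
      (k < n → S ⊆ Wset g B (k + 1)) →
      (∀ j : Fin n, (j : ℕ) < k → ∃ M : ℝ, ∀ v ∈ S, ‖∑ a, B j a * v a‖ ≤ M) →
      Bornology.IsBounded S)
    (hAQ : eval (fun q => A⁻¹ q.1 q.2) Q ≠ 0)
    (K : Set (Fin n → ℂ)) (hK : IsClosed K) (hKW : k < n → K ⊆ Wset g (fun j a => A⁻¹ j a) (k + 1)) :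
    ProperOn (projMap n k) ((fun p => A.mulVec p) ⁻¹' K) := by
  intro β _
  refine ⟨Metric.ball β 1, Metric.isOpen_ball, Metric.mem_ball_self one_pos, ?_⟩
  have hAc : Continuous fun p : Fin n → ℂ => A.mulVec p := by fun_prop
  have hAc' : Continuous fun p : Fin n → ℂ => A⁻¹.mulVec p := by fun_prop
  have hpc : Continuous (projMap n k) := by
    refine continuous_pi fun j => ?_
    have : (j : ℕ) < n := by omega
    simp only [projMap, this, dif_pos]
    fun_prop
  set T := {x | x ∈ (fun p => A.mulVec p) ⁻¹' K ∧ projMap n k x ∈ closure (Metric.ball β 1)} with hT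
  have hTc : IsClosed T := (hK.preimage hAc).inter (isClosed_closure.preimage hpc)
  have hS : Bornology.IsBounded ((fun p => A.mulVec p) '' T) := by
    refine hQ (fun j a => A⁻¹ j a) hAQ _ (fun h => ?_) ?_
    · rintro _ ⟨x, hx, rfl⟩
      exact hKW h hx.1
    · intro j hj
      refine ⟨‖β‖ + 1, ?_⟩
      rintro _ ⟨x, hx, rfl⟩
      have h1 : A⁻¹.mulVec (A.mulVec x) = x := by
        simp [Matrix.mulVec_mulVec, Matrix.nonsing_inv_mul _ hA]
      have h2 : ∑ a, A⁻¹ j a * (A.mulVec x) a = x j := congrFun h1 j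
      dsimp only
      rw [h2]
      have h3 : projMap n k x ∈ Metric.closedBall β 1 := Metric.closure_ball_subset_closedBall hx.2
      have h4 : ‖projMap n k x‖ ≤ ‖β‖ + 1 := by
        have := norm_le_norm_add_norm_sub' (projMap n k x) β
        rw [mem_closedBall_iff_norm] at h3
        linarith
      have h5 : x j = projMap n k x ⟨j, hj⟩ := by simp [projMap]
      rw [h5]
      exact (norm_le_pi_norm _ _).trans h4
  refine (hS.isCompact_closure.image hAc').of_isClosed_subset hTc ?_
  intro x hx
  refine ⟨A.mulVec x, subset_closure ⟨x, hx, rfl⟩, ?_⟩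
  simp [Matrix.mulVec_mulVec, Matrix.nonsing_inv_mul _ hA]


/-- for a radical system defining a smooth equidimensional algebraic set
`V ⊆ ℂ^n` of dimension `d`, there is a nonempty Zariski open set of matrices `A` such
that the restriction of `φ_{i-1}` to `crit(φ_i, V^A)` is proper, `1 ≤ i ≤ d+1`. -/
theorem statement_1 (n s d : ℕ) (f : Fin s → MvPolynomial (Fin n) ℝ)
    (V : Set (Fin n → ℂ))
    (hV : V = zLocus (Set.range fun i => MvPolynomial.map (algebraMap ℝ ℂ) (f i)))
    (hrad : (Ideal.span (Set.range fun i => MvPolynomial.map (algebraMap ℝ ℂ) (f i))).IsRadical)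
    (hne : V.Nonempty)
    (hequi : EquidimIdeal (vIdeal V) d)
    (hsmooth : singLocus V d = ∅) :
    ∃ 𝒜 : Set (Matrix (Fin n) (Fin n) ℂ),
      IsZariskiOpenMat 𝒜 ∧ 𝒜.Nonempty ∧ (∀ A ∈ 𝒜, IsUnit A.det) ∧
      ∀ A ∈ 𝒜, ∀ i : ℕ, 1 ≤ i → i ≤ d + 1 →
        ProperOn (projMap n (i - 1)) (critProj ((fun v => A⁻¹.mulVec v) '' V) d i) := by
  have hVc : IsClosed V := by
    have : V = ⋂ i, {x | eval x (MvPolynomial.map (algebraMap ℝ ℂ) (f i)) = 0} := by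
      rw [hV]
      ext x
      simp [zLocus]
    rw [this]
    exact isClosed_iInter fun i => isClosed_eq (MvPolynomial.continuous_eval _) continuous_const
  have hdn : d ≤ n := by
    obtain ⟨v, hv⟩ := hne
    have hd : Module.finrank ℂ (tangentAt V v) = d := by
      by_contra h
      have : v ∈ singLocus V d := ⟨hv, h⟩
      simp [hsmooth] at this
    have := Submodule.finrank_le (tangentAt V v)
    rw [hd] at this
    simpa using this
  obtain ⟨r, g, hg⟩ := Submodule.fg_iff_exists_fin_generating_family.1
    (IsNoetherian.noetherian (vIdeal V))
  have hg : Ideal.span (Set.range g) = vIdeal V := hg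
  have hcl : ∀ k : Fin (d + 1), BddClaim g k := fun k => bddClaim g k (by omega)
  choose Q hQ0 hQ using hcl
  let det : MvPolynomial (Fin n × Fin n) ℂ := (Matrix.mvPolynomialX (Fin n) (Fin n) ℂ).det
  have hdet0 : det ≠ 0 := Matrix.det_mvPolynomialX_ne_zero _ _
  have hdet : ∀ A : Matrix (Fin n) (Fin n) ℂ, eval (fun q => A q.1 q.2) det = A.det := by
    intro A
    rw [Matrix.eval_det_mvPolynomialX]
    rfl
  obtain ⟨N, Q', hQ'⟩ := inv_poly (∏ k, Q k)
  refine ⟨{A | ∃ p ∈ ({det * Q'} : Set _), eval (fun q => A q.1 q.2) p ≠ 0}, ⟨_, rfl⟩, ?_, ?_, ?_⟩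
  · obtain ⟨b, hb⟩ := exists_eval_ne (P := det * ∏ k, Q k)
      (mul_ne_zero hdet0 (Finset.prod_ne_zero_iff.2 fun k _ => hQ0 k))
    let B : Matrix (Fin n) (Fin n) ℂ := Matrix.of fun j a => b (j, a)
    have hbB : b = fun q => B q.1 q.2 := rfl
    rw [hbB, map_mul, hdet] at hb
    have hBd := left_ne_zero_of_mul hb
    have hBu := isUnit_iff_ne_zero.2 hBd
    have hBd' : B⁻¹.det ≠ 0 := by
      rw [Matrix.det_nonsing_inv, Ring.inverse_eq_inv']
      exact inv_ne_zero hBd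
    refine ⟨B⁻¹, det * Q', rfl, ?_⟩
    rw [map_mul, hdet, hQ' _ hBd', Matrix.nonsing_inv_nonsing_inv _ hBu]
    exact mul_ne_zero hBd' (mul_ne_zero (pow_ne_zero _ hBd') (right_ne_zero_of_mul hb))
  · rintro A ⟨p, rfl, hp⟩
    rw [map_mul, hdet] at hp
    exact isUnit_iff_ne_zero.2 (left_ne_zero_of_mul hp)
  · rintro A ⟨p, rfl, hp⟩ i hi1 hid
    rw [map_mul, hdet] at hp
    have hAd := left_ne_zero_of_mul hp
    have hA := isUnit_iff_ne_zero.2 hAd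
    have hp2 := right_ne_zero_of_mul hp
    rw [hQ' A hAd, map_prod] at hp2
    have hp3 := Finset.prod_ne_zero_iff.1 (right_ne_zero_of_mul hp2) ⟨i - 1, by omega⟩
      (Finset.mem_univ _)
    have hin : i - 1 ≤ n := by omega
    unfold critProj
    split_ifs with hi
    · have hpre : (fun v => A⁻¹.mulVec v) '' V = (fun p => A.mulVec p) ⁻¹' V := by
        ext p
        exact mem_image_inv A hA V p
      rw [hpre]
      refine proper_of_claim A hA g (i - 1) hin _ (hQ ⟨i - 1, by omega⟩) hp3 V hVc ?_
      intro hlt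
      have hid' : i - 1 + 1 = d + 1 := by omega
      rw [hid']
      exact (subset_critB V hsmooth (fun j a => A⁻¹ j a) (by omega)).trans
        (critB_subset_Wset V g hg (fun j a => A⁻¹ j a) (d + 1) (by omega))
    · have hi' : i ≤ n := by omega
      rw [critMap_inv A hA V d hsmooth i hi']
      refine proper_of_claim A hA g (i - 1) hin _ (hQ ⟨i - 1, by omega⟩) hp3 _
        (isClosed_critB V hVc hsmooth g hg _ i hi') ?_
      intro _
      have hid' : i - 1 + 1 = i := by omega
      rw [hid']
      exact critB_subset_Wset V g hg (fun j a => A⁻¹ j a) i hi'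

end
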